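/- arXiv:1902.07614 — 2 statements merged into one kernel-verified Lean document; each statement's English description precedes it below -/
import Mathlib

section
/- For every real c > 0 and all integers q ≥ 2 and k ≥ 1 there exists m₀ ∈ ℕ such that for every m ≥ m₀ and every set S ⊆ (ℤ/qℤ)^m × (ℤ/qℤ)^m with |S| ≥ c·q^{2m}, there exist vectors â, b̂ ∈ (ℤ/qℤ)^m and u₁, …, u_k ∈ (ℤ/qℤ)^m such that the map from (ℤ/qℤ)^k to (ℤ/qℤ)^m sending (λ₁,…,λ_k) to λ₁u₁ + … + λ_ku_k is injective, and for all λ, μ ∈ (ℤ/qℤ)^k the pair (â + λ₁u₁ + … + λ_ku_k, b̂ + μ₁u₁ + … + μ_ku_k) belongs to S. -/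
namespace DensityHalesJewett

open Finset Combinatorics
open scoped BigOperators

section Subspaces

variable {α β η ζ ι κ : Type}

/-- A combinatorial subspace of a combinatorial subspace. -/
def comp (V : Subspace η β ι) (W : Subspace ζ β η) : Subspace ζ β ι where
  idxFun i := (V.idxFun i).elim Sum.inl W.idxFun
  proper e := by
    obtain ⟨j, hj⟩ := W.proper e
    obtain ⟨i, hi⟩ := V.proper j
    exact ⟨i, by simp [hi, hj]⟩

@[simp] lemma comp_apply (V : Subspace η β ι) (W : Subspace ζ β η) (x : ζ → β) :
    comp V W x = V (W x) := by
  ext i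
  cases h : V.idxFun i <;> simp [comp, Subspace.coe_apply, h]

@[simp] lemma default_apply (x : ι → β) : (default : Subspace ι β ι) x = x := by
  ext i
  simp [Subspace.coe_apply, default]

/-- The subspace of `ι ⊕ κ → β` obtained by fixing the coordinates in `ι`. -/
def fixLeft (x : ι → β) : Subspace κ β (ι ⊕ κ) where
  idxFun := Sum.elim (fun i => Sum.inl (x i)) Sum.inr
  proper e := ⟨Sum.inr e, rfl⟩

@[simp] lemma fixLeft_apply (x : ι → β) (y : κ → β) : fixLeft x y = Sum.elim x y := by
  ext (i | i) <;> simp [fixLeft, Subspace.coe_apply]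

/-- The product of two combinatorial subspaces. -/
def prod (V : Subspace η β ι) (W : Subspace ζ β κ) : Subspace (η ⊕ ζ) β (ι ⊕ κ) where
  idxFun := Sum.elim (fun i => (V.idxFun i).map id Sum.inl) (fun i => (W.idxFun i).map id Sum.inr)
  proper := by
    rintro (e | e)
    · obtain ⟨i, hi⟩ := V.proper e
      exact ⟨Sum.inl i, by simp [hi]⟩
    · obtain ⟨i, hi⟩ := W.proper e
      exact ⟨Sum.inr i, by simp [hi]⟩

@[simp] lemma prod_apply (V : Subspace η β ι) (W : Subspace ζ β κ) (x : η ⊕ ζ → β) :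
    prod V W x = Sum.elim (V (x ∘ Sum.inl)) (W (x ∘ Sum.inr)) := by
  ext (i | i)
  · cases h : V.idxFun i <;> simp [prod, Subspace.coe_apply, h]
  · cases h : W.idxFun i <;> simp [prod, Subspace.coe_apply, h]

/-- The product of a combinatorial subspace with a point. -/
def fixRight (V : Subspace η β ι) (y : κ → β) : Subspace η β (ι ⊕ κ) where
  idxFun := Sum.elim V.idxFun (fun i => Sum.inl (y i))
  proper e := let ⟨i, hi⟩ := V.proper e; ⟨Sum.inl i, hi⟩

@[simp] lemma fixRight_apply (V : Subspace η β ι) (y : κ → β) (x : η → β) :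
    fixRight V y x = Sum.elim (V x) y := by
  ext (i | i) <;> simp [fixRight, Subspace.coe_apply]

/-- Enlarge the alphabet of a combinatorial subspace. -/
def mapAlphabet (f : α → β) (V : Subspace η α ι) : Subspace η β ι where
  idxFun i := (V.idxFun i).map f id
  proper e := let ⟨i, hi⟩ := V.proper e; ⟨i, by simp [hi]⟩

@[simp] lemma mapAlphabet_apply (f : α → β) (V : Subspace η α ι) (x : η → α) :
    mapAlphabet f V (f ∘ x) = f ∘ V x := by
  ext i
  cases h : V.idxFun i <;> simp [mapAlphabet, Subspace.coe_apply, h]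

lemma subspace_injective (V : Subspace η β ι) : Function.Injective V := by
  intro x y hxy
  ext e
  obtain ⟨i, hi⟩ := V.proper e
  simpa [Subspace.coe_apply, hi] using congrFun hxy i

instance [Finite β] [Finite η] [Finite ι] : Finite (Subspace η β ι) :=
  Finite.of_injective Subspace.idxFun fun _ _ h => Subspace.ext h

end Subspaces

section Density

/-- The density of a subset of a finite type. -/
noncomputable def density {X : Type} [Fintype X] (S : Set X) : ℝ := 𝔼 x, S.indicator 1 x

lemma indicator_one_le {X : Type} (S : Set X) (x : X) : S.indicator (1 : X → ℝ) x ≤ 1 :=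
  Set.indicator_le_self' (fun _ _ => zero_le_one) x

lemma indicator_one_nonneg {X : Type} (S : Set X) (x : X) : 0 ≤ S.indicator (1 : X → ℝ) x :=
  Set.indicator_nonneg (fun _ _ => zero_le_one) x

variable {X : Type} [Fintype X]

lemma density_nonneg (S : Set X) : 0 ≤ density S :=
  Finset.expect_nonneg fun x _ => indicator_one_nonneg S x

lemma density_le_one [Nonempty X] (S : Set X) : density S ≤ 1 :=
  Finset.expect_le univ_nonempty fun x _ => indicator_one_le S x

lemma density_eq_div (S : Set X) : density S = S.ncard / Fintype.card X := by
  classical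
  rw [density, Fintype.expect_eq_sum_div_card, Set.ncard_eq_toFinset_card']
  simp only [Set.indicator_apply, Pi.one_apply, Finset.sum_boole, Set.filter_mem_univ_eq_toFinset]

/-- If a finite family of sets covers all points where `g` is large, then one of them is dense. -/
lemma exists_dense_fiber {F : Type} [Fintype F] [Nonempty X] {c : ℝ} (hc : 0 < c) (g : X → ℝ)
    (hg1 : ∀ x, g x ≤ 1) (hg : c ≤ 𝔼 x, g x) (R : F → Set X)
    (h : ∀ x, c / 2 ≤ g x → ∃ f, x ∈ R f) :
    ∃ f, c / 2 / (Fintype.card F + 1) ≤ density (R f) := by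
  have key : c / 2 ≤ ∑ f, density (R f) := by
    have h1 : 𝔼 x, g x ≤ 𝔼 x, (c / 2 + ∑ f, (R f).indicator 1 x) := by
      refine Finset.expect_le_expect fun x _ => ?_
      by_cases hx : c / 2 ≤ g x
      · obtain ⟨f, hf⟩ := h x hx
        have := Finset.single_le_sum (f := fun f => (R f).indicator (1 : X → ℝ) x)
          (fun f _ => indicator_one_nonneg (R f) x) (Finset.mem_univ f)
        simp only [Set.indicator_of_mem hf, Pi.one_apply] at this
        linarith [hg1 x]
      · have := Finset.sum_nonneg (s := univ) (f := fun f => (R f).indicator (1 : X → ℝ) x)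
          (fun f _ => indicator_one_nonneg (R f) x)
        linarith
    rw [Finset.expect_add_distrib, Fintype.expect_const, Finset.expect_sum_comm] at h1
    simp only [density]
    linarith
  by_contra! hcon
  have h2 := Finset.sum_le_sum fun f (_ : f ∈ univ) => (hcon f).le
  rw [Finset.sum_const, Finset.card_univ, nsmul_eq_mul] at h2
  have h3 : (Fintype.card F : ℝ) * (c / 2 / (Fintype.card F + 1)) < c / 2 := by
    rw [← mul_div_assoc, div_lt_iff₀ (by positivity)]
    nlinarith
  linarith

end Density

/-- In high dimension, split off a prescribed set of coordinates. -/
lemma exists_split (β μ ι : Type) [Fintype β] [Fintype μ] [DecidableEq μ] [Fintype ι]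
    [DecidableEq ι] (h : Fintype.card μ ≤ Fintype.card ι) :
    ∃ n, n + Fintype.card μ = Fintype.card ι ∧ ∃ P : Subspace (μ ⊕ Fin n) β ι,
      ∀ f : (ι → β) → ℝ, 𝔼 z, f z = 𝔼 x, 𝔼 y, f (P (Sum.elim x y)) := by
  refine ⟨Fintype.card ι - Fintype.card μ, by omega, ?_⟩
  set ν := Fin (Fintype.card ι - Fintype.card μ)
  have e : μ ⊕ ν ≃ ι := Fintype.equivOfCardEq (by simp [ν, h])
  let P : Subspace (μ ⊕ ν) β ι := ⟨fun i => Sum.inr (e.symm i), fun j => ⟨e j, by simp⟩⟩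
  refine ⟨P, fun f => ?_⟩
  rw [← Finset.expect_product' univ univ fun x y => f (P (Sum.elim x y)), univ_product_univ]
  refine (Fintype.expect_equiv
    ((Equiv.sumArrowEquivProdArrow μ ν β).symm.trans (e.arrowCongr (Equiv.refl β))) _ _ ?_).symm
  rintro ⟨x, y⟩
  congr 1

/-- The density Hales-Jewett property for `η`-dimensional subspaces over the alphabet `α`. -/
def HasDHJ (η α : Type) [Fintype α] : Prop :=
  ∀ c : ℝ, 0 < c → ∃ N : ℕ, ∀ (ι : Type) [Fintype ι] [DecidableEq ι], N ≤ Fintype.card ι →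
    ∀ S : Set (ι → α), c ≤ density S → ∃ V : Subspace η α ι, ∀ x, V x ∈ S

/-- The multidimensional density Hales-Jewett theorem follows from the one-dimensional one. -/
lemma HasDHJ.multidim {α : Type} [Fintype α] [Nonempty α] (h : HasDHJ Unit α) (d : ℕ) :
    HasDHJ (Fin d) α := by
  induction d with
  | zero =>
    refine fun c hc => ⟨0, fun ι _ _ _ S hS => ?_⟩
    obtain ⟨x, -, hx⟩ := Finset.exists_lt_of_lt_expect univ_nonempty (hc.trans_le hS)
    refine ⟨⟨fun i => Sum.inl (x i), fun e => e.elim0⟩, fun y => ?_⟩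
    exact Set.mem_of_indicator_ne_zero hx.ne'
  | succ d ih =>
    intro c hc
    obtain ⟨M, hM⟩ := ih (c / 2) (by positivity)
    have := Fintype.ofFinite (Subspace (Fin d) α (Fin M))
    obtain ⟨N, hN⟩ := h (c / 2 / (Fintype.card (Subspace (Fin d) α (Fin M)) + 1)) (by positivity)
    refine ⟨M + N, fun ι _ _ hι S hS => ?_⟩
    obtain ⟨n, hn, P, hP⟩ := exists_split α (Fin M) ι (by simp; omega)
    rw [Fintype.card_fin] at hn
    rw [density, hP, Finset.expect_comm] at hS
    obtain ⟨V, hV⟩ := exists_dense_fiber hc _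
      (fun y => Finset.expect_le univ_nonempty fun x _ => indicator_one_le _ _) hS
      (fun V : Subspace (Fin d) α (Fin M) => {y | ∀ x, P (Sum.elim (V x) y) ∈ S})
      (fun y hy => hM (Fin M) (by simp) {x | P (Sum.elim x y) ∈ S} hy)
    obtain ⟨W, hW⟩ := hN (Fin n) (by simp; omega) _ hV
    have e : Fin d ⊕ Unit ≃ Fin (d + 1) := Fintype.equivOfCardEq (by simp)
    refine ⟨(comp P (prod V W)).reindex e (Equiv.refl α) (Equiv.refl ι), fun x => ?_⟩
    have := hW ((x ∘ e) ∘ Sum.inr) ((x ∘ e) ∘ Sum.inl)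
    convert this using 1
    ext i
    simp

section Insensitive

variable {α η ι : Type}

/-- Replace every extra letter `none` of a word by `a`. -/
def fill (a : α) (x : ι → Option α) : ι → Option α := fun i => some ((x i).getD a)

/-- A set of words is insensitive if membership does not change when the letters `none` are
replaced by `a`. -/
def Insensitive (a : α) (E : Set (ι → Option α)) : Prop := ∀ x, fill a x ∈ E ↔ x ∈ E

lemma fill_subspace (a : α) (V : Subspace η (Option α) ι) (x : η → Option α) :
    fill a (V (fill a x)) = fill a (V x) := by
  ext1 i
  cases h : V.idxFun i <;> simp [fill, Subspace.coe_apply, h]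

lemma Insensitive.comap {a : α} {E : Set (ι → Option α)} (hE : Insensitive a E)
    (V : Subspace η (Option α) ι) : Insensitive a {x | V x ∈ E} := by
  intro x
  change V (fill a x) ∈ E ↔ V x ∈ E
  rw [← hE, fill_subspace, hE]

lemma Insensitive.compl {a : α} {E : Set (ι → Option α)} (hE : Insensitive a E) :
    Insensitive a Eᶜ := fun x => not_congr (hE x)

/-- The word which is `z` on `s` and `none` elsewhere. -/
def supportedWord [DecidableEq ι] (s : Finset ι) (z : s → α) (i : ι) : Option α :=
  if h : i ∈ s then some (z ⟨i, h⟩) else none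

lemma supportedWord_bijective [DecidableEq ι] [Fintype ι] :
    Function.Bijective fun p : (s : Finset ι) × (s → α) => supportedWord p.1 p.2 := by
  constructor
  · rintro ⟨s, z⟩ ⟨t, w⟩ h
    have hst : s = t := by
      ext i
      have := congrArg Option.isSome (congrFun h i)
      by_cases h1 : i ∈ s <;> by_cases h2 : i ∈ t <;> simp_all [supportedWord]
    subst hst
    congr
    ext ⟨i, hi⟩
    simpa [supportedWord, hi] using congrFun h i
  · intro x
    refine ⟨⟨univ.filter fun i => (x i).isSome, fun i => (x i).get (Finset.mem_filter.1 i.2).2⟩, ?_⟩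
    ext1 i
    cases h : x i <;> simp [supportedWord, h]

/-- A subspace over the alphabet `α` of words supported on `s`, as a subspace over `Option α`. -/
def extendSubspace [DecidableEq ι] (s : Finset ι) (V : Subspace η α s) :
    Subspace η (Option α) ι where
  idxFun i := if h : i ∈ s then (V.idxFun ⟨i, h⟩).map some id else Sum.inl none
  proper e := let ⟨i, hi⟩ := V.proper e; ⟨i, by simp [hi]⟩

lemma fill_extendSubspace [DecidableEq ι] (s : Finset ι) (V : Subspace η α s) (a : α)
    (x : η → Option α) :
    fill a (extendSubspace s V x) = fill a (supportedWord s (V fun e => (x e).getD a)) := by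
  ext1 i
  by_cases h : i ∈ s
  · cases h' : V.idxFun ⟨i, h⟩ <;>
      simp [fill, supportedWord, extendSubspace, Subspace.coe_apply, h, h']
  · simp [fill, supportedWord, extendSubspace, Subspace.coe_apply, h]

/-- Dense insensitive sets contain combinatorial subspaces over the larger alphabet. -/
lemma exists_subspace_of_insensitive [Fintype α] [Nonempty α] (h : HasDHJ η α) {c : ℝ}
    (hc : 0 < c) :
    ∃ M : ℕ, ∀ (ι : Type) [Fintype ι] [DecidableEq ι], M ≤ Fintype.card ι →
      ∀ (a : α) (E : Set (ι → Option α)), Insensitive a E → c ≤ density E →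
        ∃ V : Subspace η (Option α) ι, ∀ x, V x ∈ E := by
  obtain ⟨N, hN⟩ := h (c / 2) (by positivity)
  set k : ℝ := (Fintype.card α : ℝ) with hk
  have hk0 : 0 < k := by simp [hk, Fintype.card_pos]
  set ρ : ℝ := (k / 2 + 1) / (k + 1) with hρ
  have hρ0 : 0 ≤ ρ := by positivity
  have hρ1 : ρ < 1 := by rw [hρ, div_lt_one (by positivity)]; linarith
  obtain ⟨M, hM⟩ := exists_pow_lt_of_lt_one (show 0 < c / 2 / 2 ^ N by positivity) hρ1
  refine ⟨M, fun ι _ _ hι a E hE hdens => ?_⟩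
  by_contra hV
  have hfib (s : Finset ι) : ∑ z : s → α, E.indicator (1 : (ι → Option α) → ℝ) (supportedWord s z) ≤
      c / 2 * k ^ #s + 2 ^ N * (k / 2) ^ #s := by
    have hcard : (Fintype.card (s → α) : ℝ) = k ^ #s := by simp [hk]
    obtain hs | hs := le_or_gt N #s
    · have hlt : density {z : s → α | supportedWord s z ∈ E} < c / 2 := by
        by_contra! hge
        obtain ⟨V, hVE⟩ := hN s (by simpa using hs) _ hge
        refine hV ⟨extendSubspace s V, fun x => ?_⟩
        rw [← hE, fill_extendSubspace, hE]
        exact hVE _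
      rw [density, Fintype.expect_eq_sum_div_card, div_lt_iff₀ (by rw [hcard]; positivity),
        hcard] at hlt
      have : 0 ≤ 2 ^ N * (k / 2) ^ #s := by positivity
      exact hlt.le.trans (by linarith)
    · calc ∑ z : s → α, E.indicator (1 : (ι → Option α) → ℝ) (supportedWord s z)
          ≤ ∑ z : s → α, (1 : ℝ) := Finset.sum_le_sum fun z _ => indicator_one_le _ _
        _ = k ^ #s := by simp [hk]
        _ = 2 ^ #s * (k / 2) ^ #s := by rw [← mul_pow]; congr 1; ring
        _ ≤ 2 ^ N * (k / 2) ^ #s := by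
            gcongr
            exact one_le_two
        _ ≤ _ := by
            have : 0 ≤ c / 2 * k ^ #s := by positivity
            linarith
  have hsum : ∑ x : ι → Option α, E.indicator (1 : (ι → Option α) → ℝ) x ≤
      c / 2 * (k + 1) ^ Fintype.card ι + 2 ^ N * (k / 2 + 1) ^ Fintype.card ι := by
    rw [← supportedWord_bijective.sum_comp, Fintype.sum_sigma]
    refine (Finset.sum_le_sum fun s _ => hfib s).trans_eq ?_
    rw [← Fintype.sum_pow_mul_eq_add_pow, ← Fintype.sum_pow_mul_eq_add_pow, Finset.mul_sum,
      Finset.mul_sum, ← Finset.sum_add_distrib]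
    simp
  have hcard : (Fintype.card (ι → Option α) : ℝ) = (k + 1) ^ Fintype.card ι := by simp [hk]
  rw [density, Fintype.expect_eq_sum_div_card, hcard, le_div_iff₀ (by positivity)] at hdens
  have hsmall : 2 ^ N * (k / 2 + 1) ^ Fintype.card ι < c / 2 * (k + 1) ^ Fintype.card ι := by
    have h1 : ρ ^ Fintype.card ι < c / 2 / 2 ^ N :=
      (pow_le_pow_of_le_one hρ0 hρ1.le hι).trans_lt hM
    rw [hρ, div_pow, div_lt_iff₀ (by positivity), div_mul_eq_mul_div,
      lt_div_iff₀ (by positivity)] at h1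
    linarith
  linarith

end Insensitive

section Increment

variable {α : Type} [Fintype α]

/-- The union of a chosen `η`-dimensional subspace contained in `Z`, if there is one. -/
noncomputable def chosenSubspace {ι : Type} (η β : Type) (Z : Set (ι → β)) : Set (ι → β) :=
  {x | ∃ h : ∃ V : Subspace η β ι, ∀ z, V z ∈ Z, x ∈ Set.range h.choose}

lemma chosenSubspace_subset {ι η β : Type} (Z : Set (ι → β)) : chosenSubspace η β Z ⊆ Z := by
  rintro _ ⟨h, z, rfl⟩
  exact h.choose_spec z

lemma chosenSubspace_eq_range {ι η β : Type} {Z : Set (ι → β)}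
    (h : ∃ V : Subspace η β ι, ∀ z, V z ∈ Z) :
    ∃ V : Subspace η β ι, chosenSubspace η β Z = Set.range V :=
  ⟨h.choose, by ext x; simp [chosenSubspace, h]⟩

lemma chosenSubspace_eq_empty {ι η β : Type} {Z : Set (ι → β)}
    (h : ¬∃ V : Subspace η β ι, ∀ z, V z ∈ Z) : chosenSubspace η β Z = ∅ := by
  ext x
  simp only [chosenSubspace, h, IsEmpty.exists_iff]
  simp

lemma sum_range_subspace {ι η β : Type} [Fintype ι] [DecidableEq ι] [Fintype η] [DecidableEq η]
    [Fintype β] (V : Subspace η β ι) (w : (ι → β) → ℝ) :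
    ∑ x, (Set.range V).indicator w x = ∑ z, w (V z) := by
  classical
  rw [← Finset.sum_image (f := w) (g := V) (s := univ) (subspace_injective V).injOn,
    ← Finset.sum_indicator_subset w (Finset.subset_univ _)]
  simp

lemma expect_insensitive_le_aux [Nonempty α] {d M : ℕ} {b : ℝ} (hb : 0 ≤ b)
    (hM : ∀ (a : α) (E : Set (Fin M → Option α)), Insensitive a E → b ≤ density E →
      ∃ V : Subspace (Fin d) (Option α) (Fin M), ∀ x, V x ∈ E) (r : ℕ) :
    ∀ (ι : Type) [Fintype ι] [DecidableEq ι], r * M ≤ Fintype.card ι →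
      ∀ w : (ι → Option α) → ℝ, (∀ x, w x ≤ 1) →
        (∀ V : Subspace (Fin d) (Option α) ι, 𝔼 x, w (V x) ≤ 0) →
        ∀ (a : α) (E : Set (ι → Option α)), Insensitive a E →
          𝔼 x, E.indicator w x ≤
            b + (1 - 1 / Fintype.card (Fin M → Option α)) ^ r * (density E - b) := by
  set κ : ℝ := 1 / (Fintype.card (Fin M → Option α) : ℝ) with hκ
  have hcard1 : (1 : ℝ) ≤ Fintype.card (Fin M → Option α) := by
    exact_mod_cast Fintype.card_pos
  have hκ0 : 0 < κ := by positivity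
  have hκ1 : 0 ≤ 1 - κ := by
    rw [hκ, sub_nonneg, div_le_one (by linarith)]
    exact hcard1
  induction r with
  | zero =>
    intro ι _ _ _ w hw1 _ a E _
    rw [pow_zero, one_mul, add_sub_cancel]
    exact Finset.expect_le_expect fun x _ => Set.indicator_le_indicator (hw1 x)
  | succ r ih =>
    intro ι _ _ hι w hw1 hw a E hE
    rw [add_mul, one_mul] at hι
    obtain ⟨n, hn, P, hP⟩ := exists_split (Option α) (Fin M) ι (by simp; omega)
    rw [Fintype.card_fin] at hn
    let Z (y : Fin n → Option α) : Set (Fin M → Option α) := {x | P (Sum.elim x y) ∈ E}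
    have hZ (y) : Insensitive a (Z y) := by
      simpa [Z] using hE.comap (comp P (fixRight (default : Subspace (Fin M) (Option α) (Fin M)) y))
    let Φ (y : Fin n → Option α) := chosenSubspace (Fin d) (Option α) (Z y)
    let E' (x : Fin M → Option α) : Set (Fin n → Option α) := {y | x ∈ Z y ∧ x ∉ Φ y}
    have hZfill (y) : Z (fill a y) = Z y := by
      ext x
      simpa [Z] using hE.comap (comp P (fixLeft x)) y
    have hE' (x) : Insensitive a (E' x) := by
      intro y
      simp only [E', Φ, Set.mem_ofPred_eq, hZfill]
    have hsplit (f : (ι → Option α) → ℝ) (x y) : E.indicator f (P (Sum.elim x y)) =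
        (Φ y).indicator (fun x => f (P (Sum.elim x y))) x +
        (E' x).indicator (fun y => f (P (Sum.elim x y))) y := by
      have hmem : P (Sum.elim x y) ∈ E ↔ x ∈ Z y := Iff.rfl
      have hsub : x ∈ Φ y → x ∈ Z y := fun h => chosenSubspace_subset _ h
      by_cases h1 : x ∈ Z y <;> by_cases h2 : x ∈ Φ y <;>
        simp_all [E']
    have hchosen (y) : 𝔼 x, (Φ y).indicator (fun x => w (P (Sum.elim x y))) x ≤ 0 := by
      by_cases h : ∃ V : Subspace (Fin d) (Option α) (Fin M), ∀ z, V z ∈ Z y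
      · obtain ⟨V, hV⟩ := chosenSubspace_eq_range h
        have h0 := hw (comp P (fixRight V y))
        rw [Fintype.expect_eq_sum_div_card, div_le_iff₀ (by exact_mod_cast Fintype.card_pos),
          zero_mul] at h0
        simp only [Φ, hV]
        rw [Fintype.expect_eq_sum_div_card, sum_range_subspace]
        exact div_nonpos_of_nonpos_of_nonneg (by simpa using h0) (Nat.cast_nonneg _)
      · simp [Φ, chosenSubspace_eq_empty h]
    have hremoved (y) : κ * (density (Z y) - b) ≤ density (Φ y) := by
      by_cases h : ∃ V : Subspace (Fin d) (Option α) (Fin M), ∀ z, V z ∈ Z y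
      · obtain ⟨V, hV⟩ := chosenSubspace_eq_range h
        simp only [Φ, hV]
        rw [density, density, Fintype.expect_eq_sum_div_card, Fintype.expect_eq_sum_div_card,
          sum_range_subspace]
        rw [← Fintype.expect_eq_sum_div_card]
        have h1 : κ * (density (Z y) - b) ≤ κ * 1 := by
          gcongr
          linarith [density_le_one (Z y)]
        refine h1.trans ?_
        rw [mul_one, hκ]
        gcongr
        simp
        exact_mod_cast Nat.one_le_pow _ _ (Nat.succ_pos _)
      · have hlt : density (Z y) < b := by
          by_contra! hge
          exact h (hM a _ (hZ y) hge)
        exact (mul_nonpos_of_nonneg_of_nonpos hκ0.le (by linarith)).trans (density_nonneg _)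
    have hrest (x) : 𝔼 y, (E' x).indicator (fun y => w (P (Sum.elim x y))) y ≤
        b + (1 - κ) ^ r * (density (E' x) - b) := by
      refine ih (Fin n) (by simp; omega) _ (fun y => hw1 _) (fun V => ?_) a _ (hE' x)
      simpa using hw (comp P (comp (fixLeft x) V))
    have hZdens : 𝔼 y, density (Z y) = density E := by
      rw [density, hP, Finset.expect_comm]
      rfl
    have hdens : 𝔼 y, density (Φ y) + 𝔼 x, density (E' x) = density E := by
      rw [density, hP]
      simp only [hsplit, Finset.expect_add_distrib]
      rw [Finset.expect_comm]
      rfl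
    have hloss : κ * (density E - b) ≤ 𝔼 y, density (Φ y) := by
      refine le_trans (le_of_eq ?_) (Finset.expect_le_expect fun y _ => hremoved y)
      rw [← Finset.mul_expect, Finset.expect_sub_distrib, Fintype.expect_const, hZdens]
    calc 𝔼 z, E.indicator w z
        = 𝔼 y, 𝔼 x, (Φ y).indicator (fun x => w (P (Sum.elim x y))) x +
          𝔼 x, 𝔼 y, (E' x).indicator (fun y => w (P (Sum.elim x y))) y := by
          rw [hP]
          simp only [hsplit, Finset.expect_add_distrib]
          rw [Finset.expect_comm]
      _ ≤ 0 + 𝔼 x, (b + (1 - κ) ^ r * (density (E' x) - b)) :=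
          add_le_add (Finset.expect_le univ_nonempty fun y _ => hchosen y)
            (Finset.expect_le_expect fun x _ => hrest x)
      _ = b + (1 - κ) ^ r * (𝔼 x, density (E' x) - b) := by
          rw [zero_add, Finset.expect_add_distrib, ← Finset.mul_expect,
            Finset.expect_sub_distrib, Fintype.expect_const]
      _ ≤ b + (1 - κ) ^ (r + 1) * (density E - b) := by
          rw [pow_succ, mul_assoc]
          have := pow_nonneg hκ1 r
          gcongr
          linarith

/-- A function bounded by `1` with nonpositive averages on all `d`-dimensional subspaces has
almost nonpositive average on insensitive sets. -/
lemma expect_insensitive_le [Nonempty α] (hα : HasDHJ Unit α) (d : ℕ) {ε : ℝ} (hε : 0 < ε) :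
    ∃ N : ℕ, ∀ (ι : Type) [Fintype ι] [DecidableEq ι], N ≤ Fintype.card ι →
      ∀ w : (ι → Option α) → ℝ, (∀ x, w x ≤ 1) →
        (∀ V : Subspace (Fin d) (Option α) ι, 𝔼 x, w (V x) ≤ 0) →
        ∀ (a : α) (E : Set (ι → Option α)), Insensitive a E → 𝔼 x, E.indicator w x ≤ ε := by
  obtain ⟨M, hM⟩ := exists_subspace_of_insensitive (hα.multidim d) (half_pos hε)
  set κ : ℝ := 1 / (Fintype.card (Fin M → Option α) : ℝ) with hκ
  have hcard1 : (1 : ℝ) ≤ Fintype.card (Fin M → Option α) := by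
    exact_mod_cast Fintype.card_pos
  have hκ0 : 0 < κ := by positivity
  have hκ1 : 0 ≤ 1 - κ := by
    rw [hκ, sub_nonneg, div_le_one (by linarith)]
    exact hcard1
  obtain ⟨r, hr⟩ := exists_pow_lt_of_lt_one (half_pos hε) (show 1 - κ < 1 by linarith)
  refine ⟨r * M, fun ι _ _ hι w hw1 hw a E hE => ?_⟩
  have h := expect_insensitive_le_aux (half_pos hε).le (hM (Fin M) (by simp)) r ι hι w hw1 hw a E hE
  have h1 : (1 - κ) ^ r * (density E - ε / 2) ≤ (1 - κ) ^ r * 1 := by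
    gcongr
    linarith [density_le_one E]
  linarith

/-- A function bounded by `1` with nonpositive averages on all `d`-dimensional subspaces has
almost nonpositive average on intersections of insensitive sets. -/
lemma expect_iInter_insensitive_le [Nonempty α] (hα : HasDHJ Unit α) (I : Finset α) :
    ∀ (d : ℕ) (ε : ℝ), 0 < ε →
    ∃ N : ℕ, ∀ (ι : Type) [Fintype ι] [DecidableEq ι], N ≤ Fintype.card ι →
      ∀ w : (ι → Option α) → ℝ, (∀ x, w x ≤ 1) →
        (∀ V : Subspace (Fin d) (Option α) ι, 𝔼 x, w (V x) ≤ 0) →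
        ∀ D : α → Set (ι → Option α), (∀ a, Insensitive a (D a)) →
          𝔼 x, (⋂ a ∈ I, D a).indicator w x ≤ ε := by
  classical
  induction I using Finset.induction_on with
  | empty =>
    refine fun d ε hε => ⟨d, fun ι _ _ hι w _ hw D _ => ?_⟩
    obtain ⟨n, -, P, hP⟩ := exists_split (Option α) (Fin d) ι (by simpa using hι)
    simp only [Finset.notMem_empty, Set.iInter_of_empty, Set.iInter_univ, Set.indicator_univ]
    rw [hP, Finset.expect_comm]
    refine (Finset.expect_le univ_nonempty fun y _ => ?_).trans hε.le
    simpa using hw (comp P (fixRight (default : Subspace (Fin d) (Option α) (Fin d)) y))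
  | insert a I _ ih =>
    intro d ε hε
    obtain ⟨n, hn⟩ := ih d (ε / 2) (by positivity)
    obtain ⟨N, hN⟩ := expect_insensitive_le hα n (half_pos hε)
    refine ⟨N, fun ι _ _ hι w hw1 hw D hD => ?_⟩
    set D' := ⋂ b ∈ I, D b
    have h := hN ι hι (fun x => D'.indicator w x - ε / 2) (fun x => ?_) (fun V => ?_) a (D a) (hD a)
    · have hle : 𝔼 x, (⋂ b ∈ insert a I, D b).indicator w x ≤
          𝔼 x, ((D a).indicator (fun x => D'.indicator w x - ε / 2) x + ε / 2) := by
        refine Finset.expect_le_expect fun x _ => ?_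
        rw [Finset.set_biInter_insert, ← Set.indicator_indicator]
        by_cases hx : x ∈ D a
        · simp [hx, D']
        · simpa [hx] using (half_pos hε).le
      rw [Finset.expect_add_distrib, Fintype.expect_const] at hle
      linarith
    · have : D'.indicator w x ≤ 1 :=
        Set.indicator_le' (fun x _ => hw1 x) (fun x _ => zero_le_one) x
      linarith
    · rw [Finset.expect_sub_distrib, Fintype.expect_const, sub_nonpos]
      have := hn (Fin n) (by simp) (fun x => w (V x)) (fun x => hw1 _)
        (fun W => by simpa using hw (comp V W)) (fun b => {x | V x ∈ D b}) fun b => (hD b).comap V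
      convert this using 3 with x
      simp [D', Set.indicator_apply]

/-- The same bound for the complement of an intersection of insensitive sets. -/
lemma expect_compl_iInter_insensitive_le [Nonempty α] (hα : HasDHJ Unit α) (I : Finset α) :
    ∀ (d : ℕ) (ε : ℝ), 0 < ε →
    ∃ N : ℕ, ∀ (ι : Type) [Fintype ι] [DecidableEq ι], N ≤ Fintype.card ι →
      ∀ w : (ι → Option α) → ℝ, (∀ x, w x ≤ 1) →
        (∀ V : Subspace (Fin d) (Option α) ι, 𝔼 x, w (V x) ≤ 0) →
        ∀ D : α → Set (ι → Option α), (∀ a, Insensitive a (D a)) →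
          𝔼 x, (⋂ a ∈ I, D a)ᶜ.indicator w x ≤ ε := by
  classical
  induction I using Finset.induction_on with
  | empty =>
    refine fun d ε hε => ⟨0, fun ι _ _ _ w _ _ D _ => ?_⟩
    simpa using hε.le
  | insert a I ha ih =>
    intro d ε hε
    obtain ⟨N₁, hN₁⟩ := ih d (ε / 2) (by positivity)
    obtain ⟨N₂, hN₂⟩ := expect_iInter_insensitive_le hα (insert a I) d (ε / 2) (by positivity)
    refine ⟨max N₁ N₂, fun ι _ _ hι w hw1 hw D hD => ?_⟩
    have h1 := hN₁ ι (le_of_max_le_left hι) w hw1 hw D hD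
    have h2 := hN₂ ι (le_of_max_le_right hι) w hw1 hw (Function.update D a (D a)ᶜ) fun b => by
      by_cases hb : b = a
      · subst hb
        simpa using (hD b).compl
      · simpa [hb] using hD b
    have hinter : ⋂ b ∈ I, Function.update D a (D a)ᶜ b = ⋂ b ∈ I, D b :=
      Set.iInter₂_congr fun b hb => Function.update_of_ne (ne_of_mem_of_not_mem hb ha) _ _
    rw [Finset.set_biInter_insert, hinter, Function.update_self] at h2
    have hsum : 𝔼 x, (⋂ b ∈ insert a I, D b)ᶜ.indicator w x =
        𝔼 x, (⋂ b ∈ I, D b)ᶜ.indicator w x +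
        𝔼 x, ((D a)ᶜ ∩ ⋂ b ∈ I, D b).indicator w x := by
      rw [← Finset.expect_add_distrib]
      refine Finset.expect_congr rfl fun x _ => ?_
      rw [Finset.set_biInter_insert]
      set T := ⋂ b ∈ I, D b
      by_cases hx : x ∈ D a <;> by_cases hx' : x ∈ T <;> simp [hx, hx']
    linarith

end Increment

section LineFree

variable {β ι κ η : Type}

/-- A set of words is line-free if it contains no combinatorial line. -/
def LineFree (A : Set (ι → β)) : Prop := ∀ l : Subspace Unit β ι, ∃ x, l x ∉ A

lemma LineFree.comap {A : Set (ι → β)} (hA : LineFree A) (V : Subspace η β ι) :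
    LineFree {x | V x ∈ A} := fun l => by simpa using hA (comp V l)

/-- In high dimension, line-free sets have density at most `δ`. -/
def LineFreeBound (β : Type) [Fintype β] (δ : ℝ) : Prop :=
  ∃ N : ℕ, ∀ (ι : Type) [Fintype ι] [DecidableEq ι], N ≤ Fintype.card ι →
    ∀ A : Set (ι → β), LineFree A → density A ≤ δ

/-- A line-free set of almost maximal density has almost maximal density on all sections. -/
lemma exists_dense_sections [Fintype β] [Nonempty β] {δ : ℝ}
    (hup : ∀ ε, 0 < ε → LineFreeBound β (δ + ε)) (μ : Type) [Fintype μ] [DecidableEq μ]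
    {ε : ℝ} (hε : 0 < ε) :
    ∃ ε', 0 < ε' ∧ ∃ N : ℕ, ∀ (ι : Type) [Fintype ι] [DecidableEq ι], N ≤ Fintype.card ι →
      ∀ A : Set (ι → β), LineFree A → δ - ε' ≤ density A →
        ∃ (n : ℕ) (P : Subspace (μ ⊕ Fin n) β ι),
          ∀ x, δ - ε ≤ density {y | P (Sum.elim x y) ∈ A} := by
  set k : ℝ := (Fintype.card (μ → β) : ℝ) with hk
  have hk1 : 1 ≤ k := by
    rw [hk]
    exact_mod_cast Fintype.card_pos
  refine ⟨ε / (2 * k), by positivity, ?_⟩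
  obtain ⟨N, hN⟩ := hup (ε / (2 * k)) (by positivity)
  refine ⟨N + Fintype.card μ, fun ι _ _ hι A hA hdens => ?_⟩
  obtain ⟨n, hn, P, hP⟩ := exists_split β μ ι (by omega)
  refine ⟨n, P, fun x₀ => ?_⟩
  set s : (μ → β) → ℝ := fun x => density {y | P (Sum.elim x y) ∈ A} with hs
  have hsle (x) : s x ≤ δ + ε / (2 * k) := by
    refine hN (Fin n) (by simp; omega) _ ?_
    simpa using hA.comap (comp P (fixLeft x))
  have hdef : δ + ε / (2 * k) - s x₀ ≤ ∑ x, (δ + ε / (2 * k) - s x) :=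
    Finset.single_le_sum (f := fun x => δ + ε / (2 * k) - s x)
      (fun x _ => sub_nonneg.2 (hsle x)) (Finset.mem_univ x₀)
  have hsum : density A = (∑ x, s x) / k := by
    rw [density, hP, Fintype.expect_eq_sum_div_card]
    rfl
  rw [hsum, le_div_iff₀ (by positivity)] at hdens
  rw [Finset.sum_sub_distrib, Finset.sum_const, Finset.card_univ, nsmul_eq_mul, ← hk] at hdef
  have hkε : k * (ε / (2 * k)) = ε / 2 := by field_simp
  have hpos : 0 < ε / (2 * k) := by positivity
  change δ - ε ≤ s x₀
  nlinarith

end LineFree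

section Blocks

variable {α B J T : Type}

/-- The subspace with one coordinate for each block of `J × Option B`, whose wildcards in block `j`
are `none` and the positions of the letter `none` of the word `x j`. -/
def blockSubspace (x : J → B → Option α) : Subspace J (Option α) (J × Option B) where
  idxFun p := p.2.elim (Sum.inr p.1) fun b => (x p.1 b).elim (Sum.inr p.1) (Sum.inl ∘ some)
  proper j := ⟨(j, none), rfl⟩

@[simp] lemma blockSubspace_none (x : J → B → Option α) (z : J → Option α) (j : J) :
    blockSubspace x z (j, none) = z j := by
  simp [blockSubspace, Subspace.coe_apply]

@[simp] lemma blockSubspace_some (x : J → B → Option α) (z : J → Option α) (j : J) (b : B) :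
    blockSubspace x z (j, some b) = (x j b).elim (z j) some := by
  cases h : x j b <;> simp [blockSubspace, Subspace.coe_apply, h]

/-- The line in block coordinates given by a line over the smaller alphabet. -/
def blockLine (l : Subspace Unit α J) (x : J → B → Option α) :
    Subspace Unit (Option α) (J × Option B) :=
  comp (blockSubspace x) (mapAlphabet some l)

lemma blockLine_some (l : Subspace Unit α J) (x : J → B → Option α) (a : α) :
    blockLine l x (fun _ => some a) = blockSubspace x (some ∘ l fun _ => a) := by
  rw [blockLine, comp_apply, ← mapAlphabet_apply]
  rfl

lemma mapAlphabet_wildcard {l : Subspace Unit α J} {j : J} (hj : l.idxFun j = Sum.inr ())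
    (v : Unit → Option α) : mapAlphabet some l v j = v () := by
  simp [mapAlphabet, Subspace.coe_apply, hj]

variable [DecidableEq J]

lemma blockLine_update_fill {l : Subspace Unit α J} {j : J} (hj : l.idxFun j = Sum.inr ())
    (x : J → B → Option α) (a : α) (ξ : B → Option α) :
    blockLine l (Function.update x j (fill a ξ)) (fun _ => some a) =
      blockLine l (Function.update x j ξ) (fun _ => some a) := by
  ext1 ⟨i, _ | b⟩
  · simp [blockLine]
  · obtain rfl | hi := eq_or_ne i j
    · cases h : ξ b <;> simp [blockLine, fill, h, mapAlphabet_wildcard hj]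
    · simp [blockLine, hi]

/-- The words of `blockLine` at the letter `none` form a subspace. -/
lemma exists_subspace_blockLine_none {l : Subspace Unit α J} {j : J}
    (hj : l.idxFun j = Sum.inr ()) (x : J → B → Option α) :
    ∃ Q : Subspace B (Option α) (J × Option B), ∀ ξ,
      Q ξ = blockLine l (Function.update x j ξ) fun _ => none := by
  let c : B → J × Option B → Option α ⊕ B := fun b p =>
    if p.1 = j then Sum.inr b else Sum.inl (blockLine l x (fun _ => none) p)
  let Q : Subspace B (Option α) (J × Option B) :=
    ⟨fun p => p.2.elim (Sum.inl (blockLine l x (fun _ => none) p)) (c · p),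
      fun b => ⟨(j, some b), by simp [c]⟩⟩
  have hnone (ξ i) : Q ξ (i, none) = blockLine l x (fun _ => none) (i, none) := rfl
  have hsome (ξ i b) : Q ξ (i, some b) =
      if i = j then ξ b else blockLine l x (fun _ => none) (i, some b) := by
    by_cases hi : i = j <;> simp [Q, c, Subspace.coe_apply, hi]
  refine ⟨Q, fun ξ => ?_⟩
  ext1 ⟨i, _ | b⟩
  · simp [hnone, blockLine]
  · obtain rfl | hi := eq_or_ne i j
    · cases h : ξ b <;> simp [hsome, blockLine, h, mapAlphabet_wildcard hj]
    · simp [hsome, blockLine, hi]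

variable [Fintype α] [Fintype B] [DecidableEq B]

/-- On the complement of an intersection of insensitive sets of positive density, a line-free set
has its density bounded by that of the complement. -/
lemma density_blockLine_none_le {d : ℕ} {δ ε : ℝ} (hδ : 0 ≤ δ)
    (hd : ∀ E : Set (Fin d → Option α), LineFree E → density E ≤ δ)
    (hB : ∀ w : (B → Option α) → ℝ, (∀ x, w x ≤ 1) →
      (∀ V : Subspace (Fin d) (Option α) B, 𝔼 x, w (V x) ≤ 0) →
      ∀ D : α → Set (B → Option α), (∀ a, Insensitive a (D a)) →
        𝔼 x, (⋂ a ∈ univ, D a)ᶜ.indicator w x ≤ ε)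
    {A : Set ((J × Option B) ⊕ T → Option α)} (hA : LineFree A) {l : Subspace Unit α J} {j : J}
    (hj : l.idxFun j = Sum.inr ()) (x : J → B → Option α) (t : T → Option α) :
    density {ξ | Sum.elim (blockLine l (Function.update x j ξ) fun _ => none) t ∈ A} ≤
      δ * (1 - density {ξ | ∀ a,
        Sum.elim (blockLine l (Function.update x j ξ) fun _ => some a) t ∈ A}) + ε := by
  set E := {ξ | Sum.elim (blockLine l (Function.update x j ξ) fun _ => none) t ∈ A} with hE
  set C := {ξ | ∀ a, Sum.elim (blockLine l (Function.update x j ξ) fun _ => some a) t ∈ A}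
    with hC
  have hdisj (ξ) (h1 : ξ ∈ E) (h2 : ξ ∈ C) : False := by
    obtain ⟨v, hv⟩ := hA (fixRight (blockLine l (Function.update x j ξ)) t)
    refine hv ?_
    rw [fixRight_apply]
    obtain ⟨o, rfl⟩ : ∃ o, v = fun _ => o := ⟨v (), rfl⟩
    cases o with
    | none => exact h1
    | some a => exact h2 a
  have hfree : LineFree E := by
    obtain ⟨Q, hQ⟩ := exists_subspace_blockLine_none hj x
    simpa [hQ] using hA.comap (fixRight Q t)
  have h := hB (fun ξ => E.indicator 1 ξ - δ) (fun ξ => by linarith [indicator_one_le E ξ])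
    (fun V => ?_)
    (fun a => {ξ | Sum.elim (blockLine l (Function.update x j ξ) fun _ => some a) t ∈ A})
    (fun a ξ => by simp [blockLine_update_fill hj])
  · have hinter : ⋂ a ∈ univ, {ξ | Sum.elim (blockLine l (Function.update x j ξ)
        fun _ => some a) t ∈ A} = C := by
      ext ξ
      simp [hC]
    rw [hinter] at h
    have hpt (ξ) : Cᶜ.indicator (fun ξ => E.indicator 1 ξ - δ) ξ =
        E.indicator 1 ξ - δ * (1 - C.indicator 1 ξ) := by
      by_cases h1 : ξ ∈ E <;> by_cases h2 : ξ ∈ C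
      · exact (hdisj ξ h1 h2).elim
      all_goals simp [h1, h2]
    simp only [hpt] at h
    rw [Finset.expect_sub_distrib, ← Finset.mul_expect, Finset.expect_sub_distrib,
      Fintype.expect_const] at h
    simp only [density]
    linarith
  · rw [Finset.expect_sub_distrib, Fintype.expect_const, sub_nonpos]
    exact hd _ (hfree.comap V)

end Blocks

lemma expect_update {J X : Type} [Fintype J] [DecidableEq J] [Fintype X] [Nonempty X] (j : J)
    (f : (J → X) → ℝ) : 𝔼 x, f x = 𝔼 x, 𝔼 ξ, f (Function.update x j ξ) := by
  let e : (J → X) × X → (J → X) × X := fun p => (Function.update p.1 j p.2, p.1 j)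
  have he : Function.Involutive e := fun p => by simp [e]
  calc 𝔼 x, f x = 𝔼 x, 𝔼 _ξ : X, f x := by simp only [Fintype.expect_const]
    _ = 𝔼 p : (J → X) × X, f p.1 := by
      rw [← univ_product_univ, Finset.expect_product]
    _ = 𝔼 p : (J → X) × X, f (Function.update p.1 j p.2) :=
      (Fintype.expect_equiv he.toPerm _ _ fun _ => rfl).symm
    _ = 𝔼 x, 𝔼 ξ, f (Function.update x j ξ) := by
      rw [← univ_product_univ, Finset.expect_product]

/-- If line-free sets have density at most about `δ > 0`, then this can be improved. -/
lemma LineFreeBound.improve {α : Type} [Fintype α] [Nonempty α] (hα : HasDHJ Unit α) {δ : ℝ}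
    (hδ : 0 < δ) (hup : ∀ ε, 0 < ε → LineFreeBound (Option α) (δ + ε)) :
    ∃ ε, 0 < ε ∧ LineFreeBound (Option α) (δ - ε) := by
  obtain ⟨m₀, hm₀⟩ := hα (δ / 2 / 2) (by positivity)
  set J := Fin m₀
  have := Fintype.ofFinite (Subspace Unit α J)
  set θ : ℝ := δ / 2 / 2 / (Fintype.card (Subspace Unit α J) + 1) with hθ
  have hθ0 : 0 < θ := by positivity
  have hε1 : 0 < δ * θ / 4 := by positivity
  obtain ⟨d, hd⟩ := hup (δ * θ / 4) hε1
  obtain ⟨m, hm⟩ := expect_compl_iInter_insensitive_le hα univ d (δ * θ / 4) hε1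
  set B := Fin m
  have hη : 0 < min (δ / 2) (δ * θ / 4) := by positivity
  obtain ⟨ε, hε, N, hN⟩ := exists_dense_sections hup (J × Option B) hη
  refine ⟨ε, hε, N, fun ι _ _ hι A₀ hA₀ => ?_⟩
  by_contra! hdens
  obtain ⟨n, P, hP⟩ := hN ι hι A₀ hA₀ hdens.le
  set A : Set (J × Option B ⊕ Fin n → Option α) := {x | P x ∈ A₀} with hAdef
  have hA : LineFree A := hA₀.comap P
  have hsec (p : J × Option B → Option α) :
      δ - min (δ / 2) (δ * θ / 4) ≤ 𝔼 t, A.indicator (1 : (J × Option B ⊕ Fin n → Option α) → ℝ) (Sum.elim p t) := hP p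
  have hη1 := min_le_left (δ / 2) (δ * θ / 4)
  have hη2 := min_le_right (δ / 2) (δ * θ / 4)
  let g (p : (J → B → Option α) × (Fin n → Option α)) : ℝ :=
    𝔼 z : J → α, A.indicator (1 : (J × Option B ⊕ Fin n → Option α) → ℝ) (Sum.elim (blockSubspace p.1 (some ∘ z)) p.2)
  let R (l : Subspace Unit α J) : Set ((J → B → Option α) × (Fin n → Option α)) :=
    {p | ∀ a, Sum.elim (blockLine l p.1 fun _ => some a) p.2 ∈ A}
  obtain ⟨l, hl⟩ : ∃ l, θ ≤ density (R l) := by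
    refine exists_dense_fiber (half_pos hδ) g
      (fun p => Finset.expect_le univ_nonempty fun z _ => indicator_one_le _ _) ?_ R fun p hp => ?_
    · have : 𝔼 p, g p = 𝔼 x : J → B → Option α, 𝔼 z : J → α, 𝔼 t,
          A.indicator (1 : (J × Option B ⊕ Fin n → Option α) → ℝ) (Sum.elim (blockSubspace x (some ∘ z)) t) := by
        rw [← univ_product_univ, Finset.expect_product]
        exact Finset.expect_congr rfl fun x _ => Finset.expect_comm _ _ _
      rw [this]
      refine Finset.le_expect univ_nonempty fun x _ => Finset.le_expect univ_nonempty fun z _ => ?_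
      linarith [hsec (blockSubspace x (some ∘ z))]
    · obtain ⟨l, hl⟩ := hm₀ J (by simp [J])
        {z | Sum.elim (blockSubspace p.1 (some ∘ z)) p.2 ∈ A} hp
      refine ⟨l, fun a => ?_⟩
      rw [blockLine_some]
      exact hl _
  obtain ⟨j, hj⟩ := l.proper ()
  obtain ⟨x, hx⟩ : ∃ x : J → B → Option α, θ ≤
      𝔼 ξ, 𝔼 t, (R l).indicator (1 : (J → B → Option α) × (Fin n → Option α) → ℝ)
        (Function.update x j ξ, t) := by
    rw [density, ← univ_product_univ, Finset.expect_product, expect_update j] at hl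
    obtain ⟨x, -, hx⟩ := Finset.exists_le_of_le_expect univ_nonempty hl
    exact ⟨x, hx⟩
  have hbound := Finset.expect_le_expect fun t (_ : t ∈ univ) =>
    density_blockLine_none_le (by positivity) (hd (Fin d) (by simp)) (hm B (by simp [B])) hA hj x t
  rw [Finset.expect_add_distrib, ← Finset.mul_expect, Finset.expect_sub_distrib,
    Fintype.expect_const, Fintype.expect_const] at hbound
  have hlow : δ - min (δ / 2) (δ * θ / 4) ≤ 𝔼 t, density {ξ | Sum.elim
      (blockLine l (Function.update x j ξ) fun _ => none) t ∈ A} := by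
    simp only [density]
    rw [Finset.expect_comm]
    exact Finset.le_expect univ_nonempty fun ξ _ => hsec _
  rw [Finset.expect_comm] at hx
  have hC : θ ≤ 𝔼 t, density {ξ | ∀ a, Sum.elim
      (blockLine l (Function.update x j ξ) fun _ => some a) t ∈ A} := hx
  nlinarith

lemma HasDHJ.option {α : Type} [Fintype α] [Nonempty α] (hα : HasDHJ Unit α) :
    HasDHJ Unit (Option α) := by
  set s : Set ℝ := {δ | LineFreeBound (Option α) δ}
  have hs1 : (1 : ℝ) ∈ s := ⟨0, fun ι _ _ _ A _ => density_le_one A⟩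
  have hs0 : BddBelow s := by
    refine ⟨0, fun δ ⟨N, hN⟩ => ?_⟩
    exact (density_nonneg _).trans (hN (Fin N) (by simp) ∅ fun l => ⟨fun _ => none, by simp⟩)
  have hmono {δ δ' : ℝ} (h : δ ≤ δ') : LineFreeBound (Option α) δ → LineFreeBound (Option α) δ' :=
    fun ⟨N, hN⟩ => ⟨N, fun ι _ _ hι A hA => (hN ι hι A hA).trans h⟩
  have hinf (ε : ℝ) (hε : 0 < ε) : LineFreeBound (Option α) (sInf s + ε) := by
    obtain ⟨δ, hδ, hlt⟩ := exists_lt_of_csInf_lt ⟨1, hs1⟩ (lt_add_of_pos_right (sInf s) hε)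
    exact hmono hlt.le hδ
  have hzero : sInf s ≤ 0 := by
    by_contra! hpos
    obtain ⟨ε, hε, h⟩ := LineFreeBound.improve hα hpos hinf
    linarith [csInf_le hs0 h]
  intro c hc
  obtain ⟨N, hN⟩ := hinf (c / 2) (half_pos hc)
  refine ⟨N, fun ι _ _ hι A hA => ?_⟩
  by_contra! hfree
  linarith [hN ι hι A hfree]

lemma HasDHJ.of_unique {α : Type} [Fintype α] [Unique α] : HasDHJ Unit α := by
  refine fun c hc => ⟨1, fun ι _ _ hι S hS => ?_⟩
  obtain ⟨x, -, hx⟩ := Finset.exists_lt_of_lt_expect univ_nonempty (hc.trans_le hS)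
  have : Nonempty ι := Fintype.card_pos_iff.1 hι
  refine ⟨⟨fun _ => Sum.inr (), fun _ => ⟨Classical.arbitrary ι, rfl⟩⟩, fun y => ?_⟩
  rw [Subsingleton.elim (Subspace.toFun _ y) x]
  exact Set.mem_of_indicator_ne_zero hx.ne'

lemma HasDHJ.of_equiv {η α β : Type} [Fintype α] [Fintype β] (e : α ≃ β) (h : HasDHJ η α) :
    HasDHJ η β := by
  intro c hc
  obtain ⟨N, hN⟩ := h c hc
  refine ⟨N, fun ι _ _ hι S hS => ?_⟩
  have hdens : density {x : ι → α | e ∘ x ∈ S} = density S :=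
    Fintype.expect_equiv ((Equiv.refl ι).arrowCongr e) _ _ fun x => rfl
  obtain ⟨V, hV⟩ := hN ι hι {x | e ∘ x ∈ S} (hS.trans_eq hdens.symm)
  refine ⟨mapAlphabet e V, fun y => ?_⟩
  obtain ⟨x, rfl⟩ : ∃ x, y = e ∘ x := ⟨e.symm ∘ y, by ext; simp⟩
  rw [mapAlphabet_apply]
  exact hV x

/-- The density Hales-Jewett theorem. -/
theorem hasDHJ (α : Type) [Fintype α] [Nonempty α] : HasDHJ Unit α := by
  have key : ∀ [Fintype α] [Nonempty α], HasDHJ Unit α := by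
    refine Finite.induction_empty_option (P := fun α => ∀ [Fintype α] [Nonempty α], HasDHJ Unit α)
      ?_ ?_ ?_ α
    · intro α β e h _ _
      have := Fintype.ofEquiv β e.symm
      have := e.nonempty
      exact HasDHJ.of_equiv e h
    · intro _ h
      exact h.elim fun x => x.elim
    · intro α _ h inst _
      obtain rfl : inst = instFintypeOption := Subsingleton.elim _ _
      cases isEmpty_or_nonempty α
      · exact HasDHJ.of_unique
      · exact HasDHJ.option h
  exact key

end DensityHalesJewett

open DensityHalesJewett in
theorem stmt_13 (c : ℝ) (hc : 0 < c) (q k : ℕ) (hq : 2 ≤ q) (hk : 1 ≤ k) :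
    ∃ m₀ : ℕ, ∀ m : ℕ, m₀ ≤ m →
      ∀ S : Finset ((Fin m → ZMod q) × (Fin m → ZMod q)),
        c * (q : ℝ) ^ (2 * m) ≤ (S.card : ℝ) →
        ∃ (ahat bhat : Fin m → ZMod q) (u : Fin k → (Fin m → ZMod q)),
          Function.Injective (fun lam : Fin k → ZMod q => ∑ i, lam i • u i) ∧
          ∀ lam mu : Fin k → ZMod q,
            (ahat + ∑ i, lam i • u i, bhat + ∑ i, mu i • u i) ∈ S := by
  have : NeZero q := ⟨by omega⟩
  obtain ⟨m₀, hm₀⟩ := (hasDHJ (ZMod q × ZMod q)).multidim k c hc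
  refine ⟨m₀, fun m hm S hS => ?_⟩
  let e : (Fin m → ZMod q × ZMod q) ≃ (Fin m → ZMod q) × (Fin m → ZMod q) :=
    Equiv.arrowProdEquivProdArrow (Fin m) (fun _ => ZMod q) (fun _ => ZMod q)
  have hdens : c ≤ density (e ⁻¹' (S : Set _)) := by
    rw [density_eq_div, Set.ncard_preimage_of_injective_subset_range e.injective
      (by simp), Set.ncard_coe_finset, le_div_iff₀ (by exact_mod_cast Fintype.card_pos)]
    refine le_trans (le_of_eq ?_) hS
    simp [ZMod.card, pow_mul, sq]
  obtain ⟨Q, hQ⟩ := hm₀ (Fin m) (by simpa using hm) _ hdens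
  let u : Fin k → Fin m → ZMod q := fun i p => if Q.idxFun p = Sum.inr i then 1 else 0
  have hu (lam : Fin k → ZMod q) (p : Fin m) :
      (∑ i, lam i • u i) p = (Q.idxFun p).elim (fun _ => 0) lam := by
    cases h : Q.idxFun p <;> simp [u, h]
  refine ⟨fun p => (Q.idxFun p).elim Prod.fst fun _ => 0,
    fun p => (Q.idxFun p).elim Prod.snd fun _ => 0, u, fun lam mu h => ?_, fun lam mu => ?_⟩
  · ext1 i
    obtain ⟨p, hp⟩ := Q.proper i
    have := congrFun h p
    simpa only [hu, hp, Sum.elim_inr] using this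
  · have h : e (Q fun i => (lam i, mu i)) ∈ S := hQ _
    convert h using 1
    refine Prod.ext ?_ ?_ <;> ext1 p <;> dsimp only <;> rw [Pi.add_apply, hu] <;>
      cases hp : Q.idxFun p <;> simp [e, Combinatorics.Subspace.coe_apply, hp]
end

section
/- Let T be the triangular lattice graph on vertex set ℤ × ℤ, where two vertices are adjacent if and only if their difference lies in {(1,0), (−1,0), (0,1), (0,−1), (1,−1), (−1,1)}. Then for every finite set P ⊆ ℤ × ℤ, the edge-boundary of P in T satisfies ∂_e(P) ≥ 2·g(P). -/
/-- The generating set of the triangular lattice graph on `ℤ × ℤ`. -/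
def triGens : Set (ℤ × ℤ) := {(1, 0), (-1, 0), (0, 1), (0, -1), (1, -1), (-1, 1)}

/-- The edge-boundary of `P` in the triangular lattice: the number of edges with exactly one
endpoint in `P`, counted as ordered pairs (first endpoint in `P`, second endpoint not in `P`). -/
noncomputable def triBoundary (P : Finset (ℤ × ℤ)) : ℕ :=
  Set.ncard {e : (ℤ × ℤ) × (ℤ × ℤ) | e.1 ∈ P ∧ e.2 ∉ P ∧ e.1 - e.2 ∈ triGens}

/-- `gP P` is the number of distinct first coordinates of `P`, plus the number of distinct
second coordinates of `P`, plus the number of distinct values `x + y` over `(x,y) ∈ P`. -/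
def gP (P : Finset (ℤ × ℤ)) : ℕ :=
  (P.image Prod.fst).card + (P.image Prod.snd).card + (P.image (fun p => p.1 + p.2)).card

/-- From any point of a finite set `P`, moving in a nonzero direction `-d` eventually leaves `P`; the
last point before leaving lies on the same level set of any `d`-invariant `f`. -/
theorem exists_exit_point (P : Finset (ℤ × ℤ)) {d : ℤ × ℤ} (hd : d ≠ 0) {f : ℤ × ℤ → ℤ}
    (hf : ∀ p, f (p - d) = f p) {p : ℤ × ℤ} (hp : p ∈ P) :
    ∃ q ∈ P, q - d ∉ P ∧ f q = f p := by
  by_contra! h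
  have hray : ∀ n : ℕ, p - n • d ∈ P ∧ f (p - n • d) = f p := by
    intro n
    induction n with
    | zero => simpa using hp
    | succ n ih =>
      have hstep : p - (n + 1) • d = p - n • d - d := by rw [succ_nsmul, sub_add_eq_sub_sub]
      rw [hstep]
      refine ⟨?_, (hf _).trans ih.2⟩
      by_contra hn
      exact h _ ih.1 hn ih.2
  have hinj : Function.Injective fun n : ℕ => p - n • d := fun m n hmn => by
    have hmn' : (m : ℤ) • d = (n : ℤ) • d := by
      simpa only [natCast_zsmul] using sub_right_injective hmn
    exact_mod_cast smul_left_injective ℤ hd hmn'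
  exact Set.infinite_of_injective_forall_mem hinj (fun n => (hray n).1) P.finite_toSet

/-- The number of lines in direction `d` meeting `P` (the level sets of `f`) is at most the number
of points of `P` whose translate by `-d` lies outside `P`. -/
theorem card_image_le_card_exit (P : Finset (ℤ × ℤ)) {d : ℤ × ℤ} (hd : d ≠ 0) {f : ℤ × ℤ → ℤ}
    (hf : ∀ p, f (p - d) = f p) :
    (P.image f).card ≤ (P.filter fun p => p - d ∉ P).card := by
  refine (Finset.card_le_card fun c hc => ?_).trans (Finset.card_image_le (f := f))
  obtain ⟨p, hp, rfl⟩ := Finset.mem_image.1 hc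
  obtain ⟨q, hq, hqd, hqp⟩ := exists_exit_point P hd hf hp
  exact Finset.mem_image.2 ⟨q, Finset.mem_filter.2 ⟨hq, hqd⟩, hqp⟩

/-- The edge-boundary, sorted by edge direction. -/
theorem triBoundary_eq_sum (P : Finset (ℤ × ℤ)) :
    triBoundary P =
      ∑ d ∈ ({(1, 0), (-1, 0), (0, 1), (0, -1), (1, -1), (-1, 1)} : Finset (ℤ × ℤ)),
        (P.filter fun p => p - d ∉ P).card := by
  set D : Finset (ℤ × ℤ) := {(1, 0), (-1, 0), (0, 1), (0, -1), (1, -1), (-1, 1)} with hD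
  have hgens : ∀ d, d ∈ triGens ↔ d ∈ D := fun d => by simp [triGens, hD]
  have hset : {e : (ℤ × ℤ) × (ℤ × ℤ) | e.1 ∈ P ∧ e.2 ∉ P ∧ e.1 - e.2 ∈ triGens} =
      ↑(D.biUnion fun d => (P.filter fun p => p - d ∉ P).image fun p => (p, p - d)) := by
    ext ⟨p, q⟩
    simp only [Set.mem_ofPred_eq, hgens, Finset.mem_coe, Finset.mem_biUnion, Finset.mem_image,
      Finset.mem_filter, Prod.mk.injEq]
    constructor
    · rintro ⟨hp, hq, hpq⟩
      exact ⟨p - q, hpq, p, ⟨hp, by rwa [sub_sub_cancel]⟩, rfl, sub_sub_cancel p q⟩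
    · rintro ⟨d, hd, p, ⟨hp, hq⟩, rfl, rfl⟩
      exact ⟨hp, hq, by rwa [sub_sub_cancel]⟩
  rw [triBoundary, hset, Set.ncard_coe_finset, Finset.card_biUnion]
  · exact Finset.sum_congr rfl fun d _ =>
      Finset.card_image_of_injective _ fun p q hpq => (Prod.ext_iff.1 hpq).1
  · intro d _ d' _ hne
    refine Finset.disjoint_left.2 fun e he he' => hne ?_
    obtain ⟨p, _, rfl⟩ := Finset.mem_image.1 he
    obtain ⟨q, _, hq⟩ := Finset.mem_image.1 he'
    obtain ⟨rfl, hqd⟩ := Prod.mk.inj hq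
    exact (sub_right_injective hqd).symm

theorem stmt_14 (P : Finset (ℤ × ℤ)) : 2 * gP P ≤ triBoundary P := by
  have h₁ := card_image_le_card_exit P (d := (0, 1)) (f := Prod.fst) (by simp) (by simp)
  have h₂ := card_image_le_card_exit P (d := (0, -1)) (f := Prod.fst) (by simp) (by simp)
  have h₃ := card_image_le_card_exit P (d := (1, 0)) (f := Prod.snd) (by simp) (by simp)
  have h₄ := card_image_le_card_exit P (d := (-1, 0)) (f := Prod.snd) (by simp) (by simp)
  have h₅ := card_image_le_card_exit P (d := (1, -1)) (f := fun p => p.1 + p.2) (by simp)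
    (fun p => by simp only [Prod.fst_sub, Prod.snd_sub]; ring)
  have h₆ := card_image_le_card_exit P (d := (-1, 1)) (f := fun p => p.1 + p.2) (by simp)
    (fun p => by simp only [Prod.fst_sub, Prod.snd_sub]; ring)
  rw [triBoundary_eq_sum, gP]
  repeat rw [Finset.sum_insert (by decide)]
  rw [Finset.sum_singleton]
  omega
end
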